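/- Let H ∈ C¹(ℝ^m,ℝ^m) with ∂_iH_j = ∂_jH_i, and let u = (u_1,…,u_m), u_i ∈ C³(ℝ³), be a stable solution of the Heisenberg system Δ_H u_i = H_i(u) on ℝ³ such that the system is orientable along u. Assume that for every i and every point of ℝ³, (Z(Yu_i))·(Xu_i) − (Z(Xu_i))·(Yu_i) ≤ 0, and that there is a constant C with ∫_{B_R} (x² + y²)·|∇_H u_i|² dxdydz ≤ C·R⁴ for all R > 1 and all i, where B_R = {(x,y,z) ∈ ℝ³ : (x²+y²)² + z² < R⁴}. Then for every i and every point p with |∇_H u_i(p)| ≠ 0, the intrinsic curvature of the level set vanishes: (XXu_i)(Yu_i)² − (XYu_i)(Xu_i)(Yu_i) − (YXu_i)(Xu_i)(Yu_i) + (YYu_i)(Xu_i)² = 0 at p, and moreover (XXu_i)(Xu_i)(Yu_i) − (XYu_i)(Xu_i)² + (YXu_i)(Yu_i)² − (YYu_i)(Xu_i)(Yu_i) = 0 at p. -/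

import Mathlib

open MeasureTheory Real Filter

/-- Partial derivative in the `x`-variable on `ℝ³`. -/
noncomputable def pdx3 (u : ℝ × ℝ × ℝ → ℝ) (p : ℝ × ℝ × ℝ) : ℝ :=
  deriv (fun t => u (t, p.2.1, p.2.2)) p.1

/-- Partial derivative in the `y`-variable on `ℝ³`. -/
noncomputable def pdy3 (u : ℝ × ℝ × ℝ → ℝ) (p : ℝ × ℝ × ℝ) : ℝ :=
  deriv (fun t => u (p.1, t, p.2.2)) p.2.1

/-- Partial derivative in the `z`-variable on `ℝ³`. -/
noncomputable def pdz3 (u : ℝ × ℝ × ℝ → ℝ) (p : ℝ × ℝ × ℝ) : ℝ :=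
  deriv (fun t => u (p.1, p.2.1, t)) p.2.2

/-- The Heisenberg vector field `X u = ∂ₓ u − (y/2)·∂_z u`. -/
noncomputable def Xh (u : ℝ × ℝ × ℝ → ℝ) (p : ℝ × ℝ × ℝ) : ℝ :=
  pdx3 u p - p.2.1 / 2 * pdz3 u p

/-- The Heisenberg vector field `Y u = ∂_y u + (x/2)·∂_z u`. -/
noncomputable def Yh (u : ℝ × ℝ × ℝ → ℝ) (p : ℝ × ℝ × ℝ) : ℝ :=
  pdy3 u p + p.1 / 2 * pdz3 u p

/-- The commutator field `Z u = ∂_z u`. -/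
noncomputable def Zh (u : ℝ × ℝ × ℝ → ℝ) (p : ℝ × ℝ × ℝ) : ℝ := pdz3 u p

/-- The Heisenberg sub-Laplacian `Δ_H u = X(Xu) + Y(Yu)`. -/
noncomputable def deltaH (u : ℝ × ℝ × ℝ → ℝ) (p : ℝ × ℝ × ℝ) : ℝ :=
  Xh (Xh u) p + Yh (Yh u) p

/-- The norm of the Heisenberg gradient, `|∇_H u| = √((Xu)² + (Yu)²)`. -/
noncomputable def normH (u : ℝ × ℝ × ℝ → ℝ) (p : ℝ × ℝ × ℝ) : ℝ :=
  Real.sqrt ((Xh u p) ^ 2 + (Yh u p) ^ 2)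

/-- The `j`-th partial derivative of a function `H : ℝ^m → ℝ`. -/
noncomputable def pdH {m : ℕ} (H : (Fin m → ℝ) → ℝ) (j : Fin m) (v : Fin m → ℝ) : ℝ :=
  fderiv ℝ H v (Pi.single j 1)

/-- The Heisenberg ball `B_R = {(x,y,z) : (x²+y²)² + z² < R⁴}`. -/
def ballH (R : ℝ) : Set (ℝ × ℝ × ℝ) :=
  {p : ℝ × ℝ × ℝ | (p.1 ^ 2 + p.2.1 ^ 2) ^ 2 + p.2.2 ^ 2 < R ^ 4}

/-- The Heisenberg norm `‖(x,y,z)‖_H = ((x²+y²)² + z²)^(1/4)`. -/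
noncomputable def heisNorm (p : ℝ × ℝ × ℝ) : ℝ :=
  ((p.1 ^ 2 + p.2.1 ^ 2) ^ 2 + p.2.2 ^ 2) ^ ((1 : ℝ) / 4)

lemma Xh_of_hasFDerivAt {f : ℝ × ℝ × ℝ → ℝ} {p : ℝ × ℝ × ℝ} {f' : ℝ × ℝ × ℝ →L[ℝ] ℝ}
    (h : HasFDerivAt f f' p) : Xh f p = f' (1, 0, -(p.2.1 / 2)) := by
  have h1 : HasDerivAt (fun t => f (t, p.2.1, p.2.2)) (f' (1, 0, 0)) p.1 :=
    HasFDerivAt.comp_hasDerivAt (l := f) (f := fun t : ℝ => (t, p.2.1, p.2.2)) p.1 h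
      ((hasDerivAt_id p.1).prodMk ((hasDerivAt_const _ _).prodMk (hasDerivAt_const _ _)))
  have h3 : HasDerivAt (fun t => f (p.1, p.2.1, t)) (f' (0, 0, 1)) p.2.2 :=
    HasFDerivAt.comp_hasDerivAt (l := f) (f := fun t : ℝ => (p.1, p.2.1, t)) p.2.2 h
      ((hasDerivAt_const _ _).prodMk ((hasDerivAt_const _ _).prodMk (hasDerivAt_id p.2.2)))
  rw [Xh, pdx3, pdz3, h1.deriv, h3.deriv]
  have : ((1, 0, -(p.2.1 / 2)) : ℝ × ℝ × ℝ) = (1, 0, 0) - (p.2.1 / 2) • (0, 0, 1) := by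
    simp
  rw [this, map_sub, map_smul, smul_eq_mul]

lemma Yh_of_hasFDerivAt {f : ℝ × ℝ × ℝ → ℝ} {p : ℝ × ℝ × ℝ} {f' : ℝ × ℝ × ℝ →L[ℝ] ℝ}
    (h : HasFDerivAt f f' p) : Yh f p = f' (0, 1, p.1 / 2) := by
  have h1 : HasDerivAt (fun t => f (p.1, t, p.2.2)) (f' (0, 1, 0)) p.2.1 :=
    HasFDerivAt.comp_hasDerivAt (l := f) (f := fun t : ℝ => (p.1, t, p.2.2)) p.2.1 h
      ((hasDerivAt_const _ _).prodMk ((hasDerivAt_id p.2.1).prodMk (hasDerivAt_const _ _)))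
  have h3 : HasDerivAt (fun t => f (p.1, p.2.1, t)) (f' (0, 0, 1)) p.2.2 :=
    HasFDerivAt.comp_hasDerivAt (l := f) (f := fun t : ℝ => (p.1, p.2.1, t)) p.2.2 h
      ((hasDerivAt_const _ _).prodMk ((hasDerivAt_const _ _).prodMk (hasDerivAt_id p.2.2)))
  rw [Yh, pdy3, pdz3, h1.deriv, h3.deriv]
  have : ((0, 1, p.1 / 2) : ℝ × ℝ × ℝ) = (0, 1, 0) + (p.1 / 2) • (0, 0, 1) := by
    simp
  rw [this, map_add, map_smul, smul_eq_mul]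

lemma Zh_of_hasFDerivAt {f : ℝ × ℝ × ℝ → ℝ} {p : ℝ × ℝ × ℝ} {f' : ℝ × ℝ × ℝ →L[ℝ] ℝ}
    (h : HasFDerivAt f f' p) : Zh f p = f' (0, 0, 1) := by
  have h3 : HasDerivAt (fun t => f (p.1, p.2.1, t)) (f' (0, 0, 1)) p.2.2 :=
    HasFDerivAt.comp_hasDerivAt (l := f) (f := fun t : ℝ => (p.1, p.2.1, t)) p.2.2 h
      ((hasDerivAt_const _ _).prodMk ((hasDerivAt_const _ _).prodMk (hasDerivAt_id p.2.2)))
  exact h3.deriv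

lemma Xh_eq_fderiv {f : ℝ × ℝ × ℝ → ℝ} (hf : Differentiable ℝ f) :
    Xh f = fun p => fderiv ℝ f p (1, 0, -(p.2.1 / 2)) :=
  funext fun p => Xh_of_hasFDerivAt (hf p).hasFDerivAt

lemma Yh_eq_fderiv {f : ℝ × ℝ × ℝ → ℝ} (hf : Differentiable ℝ f) :
    Yh f = fun p => fderiv ℝ f p (0, 1, p.1 / 2) :=
  funext fun p => Yh_of_hasFDerivAt (hf p).hasFDerivAt

lemma Zh_eq_fderiv {f : ℝ × ℝ × ℝ → ℝ} (hf : Differentiable ℝ f) :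
    Zh f = fun p => fderiv ℝ f p (0, 0, 1) :=
  funext fun p => Zh_of_hasFDerivAt (hf p).hasFDerivAt

lemma contDiff_Xh {n : ℕ} {f : ℝ × ℝ × ℝ → ℝ} (hf : ContDiff ℝ (n + 1) f) :
    ContDiff ℝ n (Xh f) := by
  rw [Xh_eq_fderiv (hf.differentiable (by simp))]
  exact (hf.fderiv_right le_rfl).clm_apply (by fun_prop)

lemma contDiff_Yh {n : ℕ} {f : ℝ × ℝ × ℝ → ℝ} (hf : ContDiff ℝ (n + 1) f) :
    ContDiff ℝ n (Yh f) := by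
  rw [Yh_eq_fderiv (hf.differentiable (by simp))]
  exact (hf.fderiv_right le_rfl).clm_apply (by fun_prop)

lemma contDiff_Zh {n : ℕ} {f : ℝ × ℝ × ℝ → ℝ} (hf : ContDiff ℝ (n + 1) f) :
    ContDiff ℝ n (Zh f) := by
  rw [Zh_eq_fderiv (hf.differentiable (by simp))]
  exact (hf.fderiv_right le_rfl).clm_apply (by fun_prop)

section Derivation

variable {f g : ℝ × ℝ × ℝ → ℝ} {p : ℝ × ℝ × ℝ}

lemma Xh_add (hf : DifferentiableAt ℝ f p) (hg : DifferentiableAt ℝ g p) :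
    Xh (fun q => f q + g q) p = Xh f p + Xh g p := by
  rw [Xh_of_hasFDerivAt (hf.hasFDerivAt.fun_add hg.hasFDerivAt), Xh_of_hasFDerivAt hf.hasFDerivAt,
    Xh_of_hasFDerivAt hg.hasFDerivAt, add_apply]

lemma Yh_add (hf : DifferentiableAt ℝ f p) (hg : DifferentiableAt ℝ g p) :
    Yh (fun q => f q + g q) p = Yh f p + Yh g p := by
  rw [Yh_of_hasFDerivAt (hf.hasFDerivAt.fun_add hg.hasFDerivAt), Yh_of_hasFDerivAt hf.hasFDerivAt,
    Yh_of_hasFDerivAt hg.hasFDerivAt, add_apply]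

lemma Xh_mul (hf : DifferentiableAt ℝ f p) (hg : DifferentiableAt ℝ g p) :
    Xh (fun q => f q * g q) p = f p * Xh g p + g p * Xh f p := by
  rw [Xh_of_hasFDerivAt (hf.hasFDerivAt.fun_mul hg.hasFDerivAt), Xh_of_hasFDerivAt hf.hasFDerivAt,
    Xh_of_hasFDerivAt hg.hasFDerivAt]
  simp

lemma Yh_mul (hf : DifferentiableAt ℝ f p) (hg : DifferentiableAt ℝ g p) :
    Yh (fun q => f q * g q) p = f p * Yh g p + g p * Yh f p := by
  rw [Yh_of_hasFDerivAt (hf.hasFDerivAt.fun_mul hg.hasFDerivAt), Yh_of_hasFDerivAt hf.hasFDerivAt,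
    Yh_of_hasFDerivAt hg.hasFDerivAt]
  simp

lemma Xh_comp {h : ℝ → ℝ} {h' : ℝ} (hh : HasDerivAt h h' (f p)) (hf : DifferentiableAt ℝ f p) :
    Xh (fun q => h (f q)) p = h' * Xh f p := by
  rw [Xh_of_hasFDerivAt (f := fun q => h (f q)) (hh.comp_hasFDerivAt p hf.hasFDerivAt),
    Xh_of_hasFDerivAt hf.hasFDerivAt]
  simp

lemma Yh_comp {h : ℝ → ℝ} {h' : ℝ} (hh : HasDerivAt h h' (f p)) (hf : DifferentiableAt ℝ f p) :
    Yh (fun q => h (f q)) p = h' * Yh f p := by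
  rw [Yh_of_hasFDerivAt (f := fun q => h (f q)) (hh.comp_hasFDerivAt p hf.hasFDerivAt),
    Yh_of_hasFDerivAt hf.hasFDerivAt]
  simp

lemma Xh_sum {ι : Type*} (s : Finset ι) {F : ι → ℝ × ℝ × ℝ → ℝ}
    (hF : ∀ i ∈ s, DifferentiableAt ℝ (F i) p) :
    Xh (fun q => ∑ i ∈ s, F i q) p = ∑ i ∈ s, Xh (F i) p := by
  rw [Xh_of_hasFDerivAt (HasFDerivAt.fun_sum fun i hi => (hF i hi).hasFDerivAt), sum_apply]
  exact Finset.sum_congr rfl fun i hi => (Xh_of_hasFDerivAt (hF i hi).hasFDerivAt).symm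

lemma Yh_sum {ι : Type*} (s : Finset ι) {F : ι → ℝ × ℝ × ℝ → ℝ}
    (hF : ∀ i ∈ s, DifferentiableAt ℝ (F i) p) :
    Yh (fun q => ∑ i ∈ s, F i q) p = ∑ i ∈ s, Yh (F i) p := by
  rw [Yh_of_hasFDerivAt (HasFDerivAt.fun_sum fun i hi => (hF i hi).hasFDerivAt), sum_apply]
  exact Finset.sum_congr rfl fun i hi => (Yh_of_hasFDerivAt (hF i hi).hasFDerivAt).symm

end Derivation

/-- The derivative of `q ↦ Df(q)·V(q)` in the direction `w`. -/
lemma fderiv_fderiv_apply {f : ℝ × ℝ × ℝ → ℝ} (hf : ContDiff ℝ 2 f)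
    {V : ℝ × ℝ × ℝ → ℝ × ℝ × ℝ} {V' : ℝ × ℝ × ℝ →L[ℝ] ℝ × ℝ × ℝ} {p : ℝ × ℝ × ℝ}
    (hV : HasFDerivAt V V' p) :
    HasFDerivAt (fun q => fderiv ℝ f q (V q))
      ((fderiv ℝ f p).comp V' + (fderiv ℝ (fderiv ℝ f) p).flip (V p)) p := by
  have h : HasFDerivAt (fderiv ℝ f) (fderiv ℝ (fderiv ℝ f) p) p :=
    (((hf.fderiv_right (m := 1) (by norm_num)).differentiable (by simp)) p).hasFDerivAt
  exact h.clm_apply hV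

lemma fderiv_fderiv_comm {f : ℝ × ℝ × ℝ → ℝ} (hf : ContDiff ℝ 2 f) (p v w : ℝ × ℝ × ℝ) :
    fderiv ℝ (fderiv ℝ f) p v w = fderiv ℝ (fderiv ℝ f) p w v :=
  (hf.contDiffAt.isSymmSndFDerivAt (by simp)) v w

lemma hasFDerivAt_fieldX (p : ℝ × ℝ × ℝ) :
    HasFDerivAt (fun q : ℝ × ℝ × ℝ => ((1, 0, -(q.2.1 / 2)) : ℝ × ℝ × ℝ))
      ((0 : ℝ × ℝ × ℝ →L[ℝ] ℝ).prod ((0 : ℝ × ℝ × ℝ →L[ℝ] ℝ).prod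
        ((-(1 / 2) : ℝ) • (ContinuousLinearMap.fst ℝ ℝ ℝ).comp
          (ContinuousLinearMap.snd ℝ ℝ (ℝ × ℝ))))) p := by
  refine (hasFDerivAt_const _ _).prodMk ((hasFDerivAt_const _ _).prodMk ?_)
  refine (ContinuousLinearMap.hasFDerivAt _).congr_of_eventuallyEq (.of_forall fun q => ?_)
  simp only [smul_apply, ContinuousLinearMap.comp_apply,
    ContinuousLinearMap.coe_snd', ContinuousLinearMap.coe_fst', smul_eq_mul]
  ring

lemma hasFDerivAt_fieldY (p : ℝ × ℝ × ℝ) :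
    HasFDerivAt (fun q : ℝ × ℝ × ℝ => ((0, 1, q.1 / 2) : ℝ × ℝ × ℝ))
      ((0 : ℝ × ℝ × ℝ →L[ℝ] ℝ).prod ((0 : ℝ × ℝ × ℝ →L[ℝ] ℝ).prod
        ((1 / 2 : ℝ) • ContinuousLinearMap.fst ℝ ℝ (ℝ × ℝ)))) p := by
  refine (hasFDerivAt_const _ _).prodMk ((hasFDerivAt_const _ _).prodMk ?_)
  refine (ContinuousLinearMap.hasFDerivAt _).congr_of_eventuallyEq (.of_forall fun q => ?_)
  simp only [smul_apply, ContinuousLinearMap.coe_fst', smul_eq_mul]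
  ring

section Commutators

variable {f : ℝ × ℝ × ℝ → ℝ}

/-- The commutation relation `[X, Y] = Z`. -/
lemma Xh_Yh_eq (hf : ContDiff ℝ 2 f) (p : ℝ × ℝ × ℝ) :
    Xh (Yh f) p = Yh (Xh f) p + Zh f p := by
  have hd : Differentiable ℝ f := hf.differentiable (by simp)
  have e : ((0, 0, 1) : ℝ × ℝ × ℝ) = (0, 0, 1 / 2) - (0, 0, -(1 / 2)) := by norm_num
  rw [Yh_eq_fderiv hd, Xh_eq_fderiv hd, Zh_eq_fderiv hd,
    Xh_of_hasFDerivAt (fderiv_fderiv_apply hf (hasFDerivAt_fieldY p)),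
    Yh_of_hasFDerivAt (fderiv_fderiv_apply hf (hasFDerivAt_fieldX p))]
  simp only [add_apply, ContinuousLinearMap.flip_apply, ContinuousLinearMap.comp_apply]
  rw [fderiv_fderiv_comm hf p (0, 1, p.1 / 2), e, map_sub]
  simp
  ring

/-- The commutation relation `[Z, X] = 0`. -/
lemma Xh_Zh_eq (hf : ContDiff ℝ 2 f) (p : ℝ × ℝ × ℝ) : Xh (Zh f) p = Zh (Xh f) p := by
  have hd : Differentiable ℝ f := hf.differentiable (by simp)
  rw [Xh_eq_fderiv hd, Zh_eq_fderiv hd,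
    Zh_of_hasFDerivAt (fderiv_fderiv_apply hf (hasFDerivAt_fieldX p)),
    Xh_of_hasFDerivAt (fderiv_fderiv_apply hf (hasFDerivAt_const (0, 0, 1) p))]
  simp only [add_apply, ContinuousLinearMap.flip_apply, ContinuousLinearMap.comp_apply]
  rw [fderiv_fderiv_comm hf p (0, 0, 1)]
  simp [show ((0, 0, 0) : ℝ × ℝ × ℝ) = 0 from rfl]

/-- The commutation relation `[Z, Y] = 0`. -/
lemma Yh_Zh_eq (hf : ContDiff ℝ 2 f) (p : ℝ × ℝ × ℝ) : Yh (Zh f) p = Zh (Yh f) p := by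
  have hd : Differentiable ℝ f := hf.differentiable (by simp)
  rw [Yh_eq_fderiv hd, Zh_eq_fderiv hd,
    Zh_of_hasFDerivAt (fderiv_fderiv_apply hf (hasFDerivAt_fieldY p)),
    Yh_of_hasFDerivAt (fderiv_fderiv_apply hf (hasFDerivAt_const (0, 0, 1) p))]
  simp only [add_apply, ContinuousLinearMap.flip_apply, ContinuousLinearMap.comp_apply]
  rw [fderiv_fderiv_comm hf p (0, 0, 1)]
  simp [show ((0, 0, 0) : ℝ × ℝ × ℝ) = 0 from rfl]

lemma Xh_deltaH (hf : ContDiff ℝ 3 f) (p : ℝ × ℝ × ℝ) :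
    Xh (deltaH f) p = deltaH (Xh f) p + 2 * Zh (Yh f) p := by
  have hX : ContDiff ℝ 2 (Xh f) := contDiff_Xh (n := 2) hf
  have hY : ContDiff ℝ 2 (Yh f) := contDiff_Yh (n := 2) hf
  have hZ : ContDiff ℝ 2 (Zh f) := contDiff_Zh (n := 2) hf
  have h2 : ContDiff ℝ 2 f := hf.of_le (by norm_num)
  have hXX : Differentiable ℝ (Xh (Xh f)) :=
    (contDiff_Xh (n := 1) hX).differentiable (by simp)
  have hYX : Differentiable ℝ (Yh (Xh f)) :=
    (contDiff_Yh (n := 1) hX).differentiable (by simp)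
  have hYY : Differentiable ℝ (Yh (Yh f)) :=
    (contDiff_Yh (n := 1) hY).differentiable (by simp)
  have e : Xh (Yh f) = fun q => Yh (Xh f) q + Zh f q := funext fun q => Xh_Yh_eq h2 q
  change Xh (fun q => Xh (Xh f) q + Yh (Yh f) q) p = _
  rw [Xh_add (hXX p) (hYY p), Xh_Yh_eq hY, e,
    Yh_add (hYX p) (hZ.differentiable (by simp) p), Yh_Zh_eq h2, deltaH]
  ring

lemma Yh_deltaH (hf : ContDiff ℝ 3 f) (p : ℝ × ℝ × ℝ) :
    Yh (deltaH f) p = deltaH (Yh f) p - 2 * Zh (Xh f) p := by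
  have hX : ContDiff ℝ 2 (Xh f) := contDiff_Xh (n := 2) hf
  have hY : ContDiff ℝ 2 (Yh f) := contDiff_Yh (n := 2) hf
  have hZ : ContDiff ℝ 2 (Zh f) := contDiff_Zh (n := 2) hf
  have h2 : ContDiff ℝ 2 f := hf.of_le (by norm_num)
  have hXX : Differentiable ℝ (Xh (Xh f)) :=
    (contDiff_Xh (n := 1) hX).differentiable (by simp)
  have hYX : Differentiable ℝ (Yh (Xh f)) :=
    (contDiff_Yh (n := 1) hX).differentiable (by simp)
  have hYY : Differentiable ℝ (Yh (Yh f)) :=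
    (contDiff_Yh (n := 1) hY).differentiable (by simp)
  have e : Xh (Yh f) = fun q => Yh (Xh f) q + Zh f q := funext fun q => Xh_Yh_eq h2 q
  change Yh (fun q => Xh (Xh f) q + Yh (Yh f) q) p = _
  rw [Yh_add (hXX p) (hYY p), deltaH, e,
    Xh_add (hYX p) (hZ.differentiable (by simp) p), Xh_Zh_eq h2, Xh_Yh_eq hX]
  ring

end Commutators

section Divergence

variable {f : ℝ × ℝ × ℝ → ℝ}

instance isAddHaarMeasure_volume_prod_prod :
    (volume : Measure (ℝ × ℝ × ℝ)).IsAddHaarMeasure :=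
  have : (volume : Measure (ℝ × ℝ)).IsAddHaarMeasure :=
    inferInstanceAs ((volume : Measure ℝ).prod volume).IsAddHaarMeasure
  inferInstanceAs ((volume : Measure ℝ).prod (volume : Measure (ℝ × ℝ))).IsAddHaarMeasure

lemma integral_fderiv_eq_zero_of_hasCompactSupport (hf : ContDiff ℝ 1 f)
    (hc : HasCompactSupport f) (v : ℝ × ℝ × ℝ) : ∫ p, fderiv ℝ f p v = 0 := by
  have hi : Integrable (fun p => fderiv ℝ f p v) :=
    ((hf.continuous_fderiv (by simp)).clm_apply continuous_const).integrable_of_hasCompactSupport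
      (hc.fderiv_apply ℝ v)
  have := integral_mul_fderiv_eq_neg_fderiv_mul_of_integrable (μ := volume)
    (f := fun _ : ℝ × ℝ × ℝ => (1 : ℝ)) (g := f) (v := v) (by simp) (by simpa using hi)
    (by simpa using hf.continuous.integrable_of_hasCompactSupport hc)
    (fun _ _ => by fun_prop) (fun p _ => hf.differentiable (by simp) p)
  simpa using this

lemma HasCompactSupport.Xh (hf : Differentiable ℝ f) (hc : HasCompactSupport f) :
    HasCompactSupport (Xh f) := by
  refine (hc.fderiv ℝ).mono fun p hp h0 => hp ?_
  rw [Xh_of_hasFDerivAt (hf p).hasFDerivAt, h0]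
  rfl

lemma HasCompactSupport.Yh (hf : Differentiable ℝ f) (hc : HasCompactSupport f) :
    HasCompactSupport (Yh f) := by
  refine (hc.fderiv ℝ).mono fun p hp h0 => hp ?_
  rw [Yh_of_hasFDerivAt (hf p).hasFDerivAt, h0]
  rfl

lemma integral_Xh_eq_zero (hf : ContDiff ℝ 1 f) (hc : HasCompactSupport f) :
    ∫ p, Xh f p = 0 := by
  have hd : Differentiable ℝ f := hf.differentiable (by simp)
  have hg : ContDiff ℝ 1 fun q : ℝ × ℝ × ℝ => q.2.1 / 2 * f q := by fun_prop
  have hgc : HasCompactSupport fun q : ℝ × ℝ × ℝ => q.2.1 / 2 * f q := hc.mul_left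
  have e : Xh f = fun p => fderiv ℝ f p (1, 0, 0)
      - fderiv ℝ (fun q : ℝ × ℝ × ℝ => q.2.1 / 2 * f q) p (0, 0, 1) := by
    funext p
    have h2 : Zh (fun q => q.2.1 / 2 * f q) p = p.2.1 / 2 * Zh f p := by
      simp only [Zh, pdz3, deriv_const_mul_field]
    rw [← Zh_of_hasFDerivAt (hg.differentiable (by simp) p).hasFDerivAt, h2, Xh_eq_fderiv hd,
      Zh_eq_fderiv hd, ← smul_eq_mul, ← map_smul, ← map_sub]
    simp
  rw [e, integral_sub, integral_fderiv_eq_zero_of_hasCompactSupport hf hc,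
    integral_fderiv_eq_zero_of_hasCompactSupport hg hgc, sub_zero]
  · exact ((hf.continuous_fderiv (by simp)).clm_apply
      continuous_const).integrable_of_hasCompactSupport (hc.fderiv_apply ℝ _)
  · exact ((hg.continuous_fderiv (by simp)).clm_apply
      continuous_const).integrable_of_hasCompactSupport (hgc.fderiv_apply ℝ _)

lemma integral_Yh_eq_zero (hf : ContDiff ℝ 1 f) (hc : HasCompactSupport f) :
    ∫ p, Yh f p = 0 := by
  have hd : Differentiable ℝ f := hf.differentiable (by simp)
  have hg : ContDiff ℝ 1 fun q : ℝ × ℝ × ℝ => q.1 / 2 * f q := by fun_prop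
  have hgc : HasCompactSupport fun q : ℝ × ℝ × ℝ => q.1 / 2 * f q := hc.mul_left
  have e : Yh f = fun p => fderiv ℝ f p (0, 1, 0)
      + fderiv ℝ (fun q : ℝ × ℝ × ℝ => q.1 / 2 * f q) p (0, 0, 1) := by
    funext p
    have h2 : Zh (fun q => q.1 / 2 * f q) p = p.1 / 2 * Zh f p := by
      simp only [Zh, pdz3, deriv_const_mul_field]
    rw [← Zh_of_hasFDerivAt (hg.differentiable (by simp) p).hasFDerivAt, h2, Yh_eq_fderiv hd,
      Zh_eq_fderiv hd, ← smul_eq_mul, ← map_smul, ← map_add]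
    simp
  rw [e, integral_add, integral_fderiv_eq_zero_of_hasCompactSupport hf hc,
    integral_fderiv_eq_zero_of_hasCompactSupport hg hgc, add_zero]
  · exact ((hf.continuous_fderiv (by simp)).clm_apply
      continuous_const).integrable_of_hasCompactSupport (hc.fderiv_apply ℝ _)
  · exact ((hg.continuous_fderiv (by simp)).clm_apply
      continuous_const).integrable_of_hasCompactSupport (hgc.fderiv_apply ℝ _)

end Divergence

section ChainRule

variable {m : ℕ} {G : (Fin m → ℝ) → ℝ} {u : Fin m → ℝ × ℝ × ℝ → ℝ}

lemma fderiv_apply_eq_sum_pdH (v w : Fin m → ℝ) :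
    fderiv ℝ G v w = ∑ j, pdH G j v * w j := by
  rw [← ContinuousLinearMap.coe_coe, LinearMap.pi_apply_eq_sum_univ]
  refine Finset.sum_congr rfl fun j _ => ?_
  rw [smul_eq_mul, mul_comm, pdH, ContinuousLinearMap.coe_coe]
  congr 2
  ext k
  simp [Pi.single_apply, eq_comm]

lemma Xh_comp_pi (hG : Differentiable ℝ G) (hu : ∀ j, Differentiable ℝ (u j)) (p : ℝ × ℝ × ℝ) :
    Xh (fun q => G fun j => u j q) p = ∑ j, pdH G j (fun k => u k p) * Xh (u j) p := by
  have h := (hG fun j => u j p).hasFDerivAt.comp (f := fun q j => u j q) p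
    (hasFDerivAt_pi.2 fun j => (hu j p).hasFDerivAt)
  rw [Xh_of_hasFDerivAt (f := fun q => G fun j => u j q) h, ContinuousLinearMap.comp_apply,
    fderiv_apply_eq_sum_pdH]
  exact Finset.sum_congr rfl fun j _ => by
    rw [Xh_of_hasFDerivAt (hu j p).hasFDerivAt, ContinuousLinearMap.pi_apply]

lemma Yh_comp_pi (hG : Differentiable ℝ G) (hu : ∀ j, Differentiable ℝ (u j)) (p : ℝ × ℝ × ℝ) :
    Yh (fun q => G fun j => u j q) p = ∑ j, pdH G j (fun k => u k p) * Yh (u j) p := by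
  have h := (hG fun j => u j p).hasFDerivAt.comp (f := fun q j => u j q) p
    (hasFDerivAt_pi.2 fun j => (hu j p).hasFDerivAt)
  rw [Yh_of_hasFDerivAt (f := fun q => G fun j => u j q) h, ContinuousLinearMap.comp_apply,
    fderiv_apply_eq_sum_pdH]
  exact Finset.sum_congr rfl fun j _ => by
    rw [Yh_of_hasFDerivAt (hu j p).hasFDerivAt, ContinuousLinearMap.pi_apply]

end ChainRule

/-- The defect in Kato's inequality for the pair `(a, b)`, which for `(a, b) = (Xu, Yu)` measures
the curvature and the tangential variation of the level sets of `u`. -/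
noncomputable def katoDefect (a b : ℝ × ℝ × ℝ → ℝ) (p : ℝ × ℝ × ℝ) : ℝ :=
  ((a p * Xh b p - b p * Xh a p) ^ 2 + (a p * Yh b p - b p * Yh a p) ^ 2)
    / (a p ^ 2 + b p ^ 2 + 1)

lemma katoDefect_nonneg (a b : ℝ × ℝ × ℝ → ℝ) (p : ℝ × ℝ × ℝ) : 0 ≤ katoDefect a b p := by
  unfold katoDefect
  positivity

lemma continuous_katoDefect {a b : ℝ × ℝ × ℝ → ℝ} (ha : ContDiff ℝ 2 a) (hb : ContDiff ℝ 2 b) :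
    Continuous (katoDefect a b) := by
  have := ha.continuous
  have := hb.continuous
  have := (contDiff_Xh (n := 1) ha).continuous
  have := (contDiff_Xh (n := 1) hb).continuous
  have := (contDiff_Yh (n := 1) ha).continuous
  have := (contDiff_Yh (n := 1) hb).continuous
  unfold katoDefect
  exact Continuous.div (by fun_prop) (by fun_prop) fun p => by positivity

/-- The algebra behind the regularized Kato inequality. -/
lemma kato_algebra {a b xa ya xb yb c : ℝ} (hc : 0 < c) (hc1 : c ≤ 1) :
    ((a * xa + b * xb) ^ 2 + (a * ya + b * yb) ^ 2) / (a ^ 2 + b ^ 2 + c)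
      + ((a * xb - b * xa) ^ 2 + (a * yb - b * ya) ^ 2) / (a ^ 2 + b ^ 2 + 1)
      ≤ xa ^ 2 + ya ^ 2 + xb ^ 2 + yb ^ 2 := by
  have hle : ((a * xb - b * xa) ^ 2 + (a * yb - b * ya) ^ 2) / (a ^ 2 + b ^ 2 + 1)
      ≤ ((a * xb - b * xa) ^ 2 + (a * yb - b * ya) ^ 2) / (a ^ 2 + b ^ 2 + c) := by
    gcongr
  refine (add_le_add_right hle _).trans ?_
  rw [← add_div, div_le_iff₀ (by positivity)]
  have : 0 ≤ c * (xa ^ 2 + ya ^ 2 + xb ^ 2 + yb ^ 2) := by positivity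
  linarith

section Kato

variable {a b η : ℝ × ℝ × ℝ → ℝ}

/-- The regularized norm `√(a² + b² + c)` of the vector `(a, b)`. -/
noncomputable def regNorm (a b : ℝ × ℝ × ℝ → ℝ) (c : ℝ) (p : ℝ × ℝ × ℝ) : ℝ :=
  √(a p ^ 2 + b p ^ 2 + c)

lemma contDiff_regNorm {n : ℕ} (ha : ContDiff ℝ n a) (hb : ContDiff ℝ n b) {c : ℝ} (hc : 0 < c) :
    ContDiff ℝ n (regNorm a b c) :=
  (((ha.pow 2).add (hb.pow 2)).add contDiff_const).sqrt fun p => by positivity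

lemma sq_regNorm {c : ℝ} (hc : 0 < c) (p : ℝ × ℝ × ℝ) :
    regNorm a b c p ^ 2 = a p ^ 2 + b p ^ 2 + c :=
  Real.sq_sqrt (by positivity)

lemma regNorm_pos {c : ℝ} (hc : 0 < c) (p : ℝ × ℝ × ℝ) : 0 < regNorm a b c p :=
  Real.sqrt_pos.2 (by positivity)

lemma Xh_regNorm (ha : Differentiable ℝ a) (hb : Differentiable ℝ b) {c : ℝ} (hc : 0 < c)
    (p : ℝ × ℝ × ℝ) :
    Xh (regNorm a b c) p = (a p * Xh a p + b p * Xh b p) / regNorm a b c p := by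
  have hpos := regNorm_pos (a := a) (b := b) hc p
  have h := congrArg (fun F => Xh F p) (funext fun q => show
    regNorm a b c q * regNorm a b c q = a q * a q + b q * b q + c by
      rw [← sq, sq_regNorm hc, sq, sq])
  have hr : DifferentiableAt ℝ (regNorm a b c) p :=
    DifferentiableAt.sqrt (by fun_prop) (by positivity)
  have hconst : Xh (fun _ => c) p = 0 := by
    rw [Xh_of_hasFDerivAt (hasFDerivAt_const c p)]; rfl
  rw [Xh_mul hr hr, Xh_add (by fun_prop) (by fun_prop), Xh_add (by fun_prop) (by fun_prop),
    Xh_mul (ha p) (ha p), Xh_mul (hb p) (hb p), hconst] at h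
  rw [eq_div_iff hpos.ne']
  linarith

lemma Yh_regNorm (ha : Differentiable ℝ a) (hb : Differentiable ℝ b) {c : ℝ} (hc : 0 < c)
    (p : ℝ × ℝ × ℝ) :
    Yh (regNorm a b c) p = (a p * Yh a p + b p * Yh b p) / regNorm a b c p := by
  have hpos := regNorm_pos (a := a) (b := b) hc p
  have h := congrArg (fun F => Yh F p) (funext fun q => show
    regNorm a b c q * regNorm a b c q = a q * a q + b q * b q + c by
      rw [← sq, sq_regNorm hc, sq, sq])
  have hr : DifferentiableAt ℝ (regNorm a b c) p :=
    DifferentiableAt.sqrt (by fun_prop) (by positivity)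
  have hconst : Yh (fun _ => c) p = 0 := by
    rw [Yh_of_hasFDerivAt (hasFDerivAt_const c p)]; rfl
  rw [Yh_mul hr hr, Yh_add (by fun_prop) (by fun_prop), Yh_add (by fun_prop) (by fun_prop),
    Yh_mul (ha p) (ha p), Yh_mul (hb p) (hb p), hconst] at h
  rw [eq_div_iff hpos.ne']
  linarith

/-- The divergence of `η²` times half the horizontal gradient of `a² + b²`. -/
noncomputable def cutoffDiv (a b η : ℝ × ℝ × ℝ → ℝ) (p : ℝ × ℝ × ℝ) : ℝ :=
  Xh (fun q => (a q * Xh a q + b q * Xh b q) * (η q * η q)) p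
    + Yh (fun q => (a q * Yh a q + b q * Yh b q) * (η q * η q)) p

lemma cutoffDiv_eq (ha : ContDiff ℝ 2 a) (hb : ContDiff ℝ 2 b) (hη : Differentiable ℝ η)
    (p : ℝ × ℝ × ℝ) :
    cutoffDiv a b η p = (Xh a p ^ 2 + Yh a p ^ 2 + Xh b p ^ 2 + Yh b p ^ 2
        + a p * deltaH a p + b p * deltaH b p) * η p ^ 2
      + 2 * η p * ((a p * Xh a p + b p * Xh b p) * Xh η p
        + (a p * Yh a p + b p * Yh b p) * Yh η p) := by
  have h1 : Differentiable ℝ a := ha.differentiable (by simp)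
  have h2 : Differentiable ℝ b := hb.differentiable (by simp)
  have h3 : Differentiable ℝ (Xh a) := (contDiff_Xh (n := 1) ha).differentiable (by simp)
  have h4 : Differentiable ℝ (Xh b) := (contDiff_Xh (n := 1) hb).differentiable (by simp)
  have h5 : Differentiable ℝ (Yh a) := (contDiff_Yh (n := 1) ha).differentiable (by simp)
  have h6 : Differentiable ℝ (Yh b) := (contDiff_Yh (n := 1) hb).differentiable (by simp)
  rw [cutoffDiv, Xh_mul (by fun_prop) (by fun_prop), Yh_mul (by fun_prop) (by fun_prop),
    Xh_mul (hη p) (hη p), Yh_mul (hη p) (hη p), Xh_add (by fun_prop) (by fun_prop),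
    Yh_add (by fun_prop) (by fun_prop), Xh_mul (h1 p) (h3 p), Xh_mul (h2 p) (h4 p),
    Yh_mul (h1 p) (h5 p), Yh_mul (h2 p) (h6 p), deltaH, deltaH]
  ring

lemma integrable_cutoffDiv (ha : ContDiff ℝ 2 a) (hb : ContDiff ℝ 2 b) (hη : ContDiff ℝ 1 η)
    (hc : HasCompactSupport η) :
    Integrable (cutoffDiv a b η) ∧ ∫ p, cutoffDiv a b η p = 0 := by
  have h1 : ContDiff ℝ 1 a := ha.of_le (by norm_num)
  have h2 : ContDiff ℝ 1 b := hb.of_le (by norm_num)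
  have h3 : ContDiff ℝ 1 (Xh a) := contDiff_Xh (n := 1) ha
  have h4 : ContDiff ℝ 1 (Xh b) := contDiff_Xh (n := 1) hb
  have h5 : ContDiff ℝ 1 (Yh a) := contDiff_Yh (n := 1) ha
  have h6 : ContDiff ℝ 1 (Yh b) := contDiff_Yh (n := 1) hb
  have hcη : HasCompactSupport fun q => η q * η q := hc.mul_left
  have hX : ContDiff ℝ 1 fun q => (a q * Xh a q + b q * Xh b q) * (η q * η q) := by fun_prop
  have hY : ContDiff ℝ 1 fun q => (a q * Yh a q + b q * Yh b q) * (η q * η q) := by fun_prop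
  have hXc : HasCompactSupport fun q => (a q * Xh a q + b q * Xh b q) * (η q * η q) :=
    hcη.mul_left
  have hYc : HasCompactSupport fun q => (a q * Yh a q + b q * Yh b q) * (η q * η q) :=
    hcη.mul_left
  have iX := (contDiff_Xh (n := 0) (by simpa using hX)).continuous.integrable_of_hasCompactSupport
    (μ := volume) (hXc.Xh (hX.differentiable (by simp)))
  have iY := (contDiff_Yh (n := 0) (by simpa using hY)).continuous.integrable_of_hasCompactSupport
    (μ := volume) (hYc.Yh (hY.differentiable (by simp)))
  refine ⟨iX.add iY, ?_⟩
  unfold cutoffDiv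
  rw [integral_add iX iY, integral_Xh_eq_zero hX hXc, integral_Yh_eq_zero hY hYc, add_zero]

/-- Pointwise energy estimate for the test function `s·√(a² + b² + c)·η` with `s² = 1`. -/
lemma energy_regNorm_mul_le (ha : ContDiff ℝ 2 a) (hb : ContDiff ℝ 2 b) (hη : Differentiable ℝ η)
    {s c : ℝ} (hs : s ^ 2 = 1) (hc : 0 < c) (hc1 : c ≤ 1) (p : ℝ × ℝ × ℝ) :
    Xh (fun q => s * regNorm a b c q * η q) p ^ 2 + Yh (fun q => s * regNorm a b c q * η q) p ^ 2
      ≤ cutoffDiv a b η p - (a p * deltaH a p + b p * deltaH b p) * η p ^ 2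
        - katoDefect a b p * η p ^ 2 + (a p ^ 2 + b p ^ 2 + c) * (Xh η p ^ 2 + Yh η p ^ 2) := by
  have h1 : Differentiable ℝ a := ha.differentiable (by simp)
  have h2 : Differentiable ℝ b := hb.differentiable (by simp)
  have hr : Differentiable ℝ (regNorm a b c) := fun p =>
    DifferentiableAt.sqrt (by fun_prop) (by positivity)
  have hconst : Xh (fun _ => s) p = 0 := by
    rw [Xh_of_hasFDerivAt (hasFDerivAt_const s p)]; rfl
  have hconst' : Yh (fun _ => s) p = 0 := by
    rw [Yh_of_hasFDerivAt (hasFDerivAt_const s p)]; rfl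
  rw [cutoffDiv_eq ha hb hη, Xh_mul (by fun_prop) (hη p), Yh_mul (by fun_prop) (hη p),
    Xh_mul (by fun_prop) (hr p), Yh_mul (by fun_prop) (hr p), hconst, hconst', Xh_regNorm h1 h2 hc,
    Yh_regNorm h1 h2 hc]
  have hk := mul_le_mul_of_nonneg_right (kato_algebra (a := a p) (b := b p) (xa := Xh a p)
    (ya := Yh a p) (xb := Xh b p) (yb := Yh b p) hc hc1) (sq_nonneg (η p))
  have hg := sq_regNorm (a := a) (b := b) hc p
  have hpos := regNorm_pos (a := a) (b := b) hc p
  have key : ∀ P e : ℝ, (s * regNorm a b c p * e + η p * (s * (P / regNorm a b c p)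
      + regNorm a b c p * 0)) ^ 2
      = (a p ^ 2 + b p ^ 2 + c) * e ^ 2 + 2 * η p * (P * e)
        + P ^ 2 / (a p ^ 2 + b p ^ 2 + c) * η p ^ 2 := by
    intro P e
    rw [← hg]
    field_simp
    linear_combination (regNorm a b c p ^ 2 * e + η p * P) ^ 2 * hs
  rw [key, key, katoDefect]
  rw [add_mul, add_div, add_mul] at hk
  linarith

end Kato

section Stability

variable {m : ℕ} {H : Fin m → (Fin m → ℝ) → ℝ} {u : Fin m → ℝ × ℝ × ℝ → ℝ}

/-- The linearized system, contracted with the horizontal gradient of `u i`. -/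
lemma linearized_system (hH : ∀ i, ContDiff ℝ 1 (H i)) (hu : ∀ i, ContDiff ℝ 3 (u i))
    (hsys : ∀ i p, deltaH (u i) p = H i (fun j => u j p)) (i : Fin m) (p : ℝ × ℝ × ℝ) :
    Xh (u i) p * deltaH (Xh (u i)) p + Yh (u i) p * deltaH (Yh (u i)) p
      = ∑ j, pdH (H i) j (fun k => u k p) * (Xh (u i) p * Xh (u j) p + Yh (u i) p * Yh (u j) p)
        - 2 * (Zh (Yh (u i)) p * Xh (u i) p - Zh (Xh (u i)) p * Yh (u i) p) := by
  have hd : ∀ j, Differentiable ℝ (u j) := fun j => (hu j).differentiable (by simp)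
  have hHd : Differentiable ℝ (H i) := (hH i).differentiable (by simp)
  have e : deltaH (u i) = fun p => H i fun j => u j p := funext (hsys i)
  have hX := Xh_deltaH (hu i) p
  have hY := Yh_deltaH (hu i) p
  rw [e, Xh_comp_pi hHd hd] at hX
  rw [e, Yh_comp_pi hHd hd] at hY
  have hsum : ∑ j, pdH (H i) j (fun k => u k p)
        * (Xh (u i) p * Xh (u j) p + Yh (u i) p * Yh (u j) p)
      = Xh (u i) p * ∑ j, pdH (H i) j (fun k => u k p) * Xh (u j) p
        + Yh (u i) p * ∑ j, pdH (H i) j (fun k => u k p) * Yh (u j) p := by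
    rw [Finset.mul_sum, Finset.mul_sum, ← Finset.sum_add_distrib]
    exact Finset.sum_congr rfl fun j _ => by ring
  rw [hsum, hX, hY]
  ring

/-- An orientation may be normalized to signs. -/
lemma exists_signs_of_orientable
    (horient : ∃ θ : Fin m → ℝ × ℝ × ℝ → ℝ,
      (∀ i, (∀ p, 0 < θ i p) ∨ (∀ p, θ i p < 0)) ∧
      (∀ i j, i ≠ j → ∀ p, pdH (H i) j (fun k => u k p) * θ i p * θ j p < 0)) :
    ∃ s : Fin m → ℝ, (∀ i, s i ^ 2 = 1) ∧
      ∀ i j, i ≠ j → ∀ p, pdH (H i) j (fun k => u k p) * (s i * s j) ≤ 0 := by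
  obtain ⟨θ, hθ, hneg⟩ := horient
  have h : ∀ i, ∃ s : ℝ, s ^ 2 = 1 ∧ ∀ p, 0 < s * θ i p := fun i => by
    rcases hθ i with h | h
    · exact ⟨1, by norm_num, fun p => by simpa using h p⟩
    · exact ⟨-1, by norm_num, fun p => by simpa using h p⟩
  choose s hs hpos using h
  refine ⟨s, hs, fun i j hij p => ?_⟩
  have hij := hneg i j hij p
  have hp := mul_pos (hpos i p) (hpos j p)
  have e : pdH (H i) j (fun k => u k p) * θ i p * θ j p
      = pdH (H i) j (fun k => u k p) * (s i * s j) * (s i * θ i p * (s j * θ j p)) := by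
    linear_combination (-(pdH (H i) j (fun k => u k p) * θ i p * θ j p) * (s j ^ 2)) * hs i
      - (pdH (H i) j (fun k => u k p) * θ i p * θ j p) * hs j
  rw [e] at hij
  exact (neg_of_mul_neg_left hij hp.le).le

lemma dot_le_regNorm_mul (a b a' b' : ℝ × ℝ × ℝ → ℝ) {c : ℝ} (hc : 0 < c) {s : ℝ} (hs : s ^ 2 = 1)
    (p : ℝ × ℝ × ℝ) :
    s * (a p * a' p + b p * b' p) ≤ regNorm a b c p * regNorm a' b' c p := by
  refine le_of_sq_le_sq ?_ (mul_pos (regNorm_pos hc p) (regNorm_pos hc p)).le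
  rw [mul_pow, mul_pow, sq_regNorm hc, sq_regNorm hc, hs]
  have : 0 ≤ c * (a p ^ 2 + b p ^ 2 + a' p ^ 2 + b' p ^ 2 + c) := by positivity
  linarith [sq_nonneg (a p * b' p - b p * a' p)]

/-- The coupling terms have a favourable sign, up to the regularization. -/
lemma coupling_le {s : Fin m → ℝ} (hs : ∀ i, s i ^ 2 = 1) {M : Fin m → Fin m → ℝ}
    (hM : ∀ i j, i ≠ j → M i j * (s i * s j) ≤ 0) (a b : Fin m → ℝ × ℝ × ℝ → ℝ) {c : ℝ}
    (hc : 0 < c) (e : ℝ) (p : ℝ × ℝ × ℝ) (i : Fin m) :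
    ∑ j, M i j * (s i * regNorm (a i) (b i) c p * e) * (s j * regNorm (a j) (b j) c p * e)
      ≤ (∑ j, M i j * (a i p * a j p + b i p * b j p)) * e ^ 2 + c * (M i i * e ^ 2) := by
  rw [← sub_le_iff_le_add', Finset.sum_mul, ← Finset.sum_sub_distrib]
  calc _ ≤ ∑ j, if j = i then c * (M i i * e ^ 2) else 0 := Finset.sum_le_sum fun j _ => ?_
    _ = _ := by simp
  split_ifs with h
  · subst h
    refine le_of_eq ?_
    linear_combination (M j j * e ^ 2 * regNorm (a j) (b j) c p ^ 2) * hs j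
      + (M j j * e ^ 2) * sq_regNorm (a := a j) (b := b j) hc p
  · have hss : (s i * s j) ^ 2 = 1 := by rw [mul_pow, hs, hs, one_mul]
    have h1 := dot_le_regNorm_mul (a i) (b i) (a j) (b j) hc hss p
    have h2 := mul_nonneg_of_nonpos_of_nonpos (hM i j (Ne.symm h)) (sub_nonpos.2 h1)
    have h3 := mul_nonneg h2 (sq_nonneg e)
    have e1 : M i j * (a i p * a j p + b i p * b j p) * e ^ 2
        = (s i * s j) ^ 2 * (M i j * (a i p * a j p + b i p * b j p) * e ^ 2) := by
      rw [hss, one_mul]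
    linarith

/-- The weighted Poincaré-type inequality satisfied by stable solutions of orientable systems. -/
lemma sum_integral_katoDefect_le
    (hH : ∀ i, ContDiff ℝ 1 (H i)) (hsymm : ∀ i j v, pdH (H j) i v = pdH (H i) j v)
    (hu : ∀ i, ContDiff ℝ 3 (u i)) (hsys : ∀ i p, deltaH (u i) p = H i (fun j => u j p))
    (hstab : ∀ ζ : Fin m → ℝ × ℝ × ℝ → ℝ, (∀ i, ContDiff ℝ 1 (ζ i)) →
      (∀ i, HasCompactSupport (ζ i)) →
      (-(∑ i, ∑ j, ∫ p, pdH (H j) i (fun k => u k p) * ζ i p * ζ j p))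
        ≤ ∑ i, ∫ p, ((Xh (ζ i) p) ^ 2 + (Yh (ζ i) p) ^ 2))
    (horient : ∃ θ : Fin m → ℝ × ℝ × ℝ → ℝ,
      (∀ i, (∀ p, 0 < θ i p) ∨ (∀ p, θ i p < 0)) ∧
      (∀ i j, i ≠ j → ∀ p, pdH (H i) j (fun k => u k p) * θ i p * θ j p < 0))
    (hsign : ∀ i p, Zh (Yh (u i)) p * Xh (u i) p - Zh (Xh (u i)) p * Yh (u i) p ≤ 0)
    {η : ℝ × ℝ × ℝ → ℝ} (hη : ContDiff ℝ 1 η) (hηc : HasCompactSupport η) :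
    ∑ i, ∫ p, katoDefect (Xh (u i)) (Yh (u i)) p * η p ^ 2
      ≤ ∑ i, ∫ p, (Xh (u i) p ^ 2 + Yh (u i) p ^ 2) * (Xh η p ^ 2 + Yh η p ^ 2) := by
  obtain ⟨s, hs, hM⟩ := exists_signs_of_orientable horient
  have hηd : Differentiable ℝ η := hη.differentiable (by simp)
  have hX : ∀ i, ContDiff ℝ 2 (Xh (u i)) := fun i => contDiff_Xh (n := 2) (hu i)
  have hY : ∀ i, ContDiff ℝ 2 (Yh (u i)) := fun i => contDiff_Yh (n := 2) (hu i)
  have cX : ∀ i, Continuous (Xh (u i)) := fun i => (hX i).continuous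
  have cY : ∀ i, Continuous (Yh (u i)) := fun i => (hY i).continuous
  have cXη : Continuous (Xh η) := (contDiff_Xh (n := 0) (by simpa using hη)).continuous
  have cYη : Continuous (Yh η) := (contDiff_Yh (n := 0) (by simpa using hη)).continuous
  have cη : Continuous η := hη.continuous
  have cM : ∀ i j, Continuous fun p => pdH (H i) j fun k => u k p := fun i j =>
    ((hH i).continuous_fderiv (by simp) |>.comp
      (continuous_pi fun k => (hu k).continuous)).clm_apply continuous_const
  have hη2 : HasCompactSupport fun p => η p ^ 2 := hηc.comp_left (g := fun t => t ^ 2) (by simp)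
  have hgrad : HasCompactSupport fun p => Xh η p ^ 2 + Yh η p ^ 2 :=
    ((hηc.Xh hηd).comp_left (g := fun t => t ^ 2) (by simp)).add
      ((hηc.Yh hηd).comp_left (g := fun t => t ^ 2) (by simp))
  have iq : ∀ i, Integrable fun p => katoDefect (Xh (u i)) (Yh (u i)) p * η p ^ 2 := fun i =>
    ((continuous_katoDefect (hX i) (hY i)).mul (cη.pow 2)).integrable_of_hasCompactSupport
      hη2.mul_left
  have iw : ∀ i, Integrable fun p =>
      (Xh (u i) p ^ 2 + Yh (u i) p ^ 2) * (Xh η p ^ 2 + Yh η p ^ 2) := fun i =>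
    Continuous.integrable_of_hasCompactSupport (by fun_prop) hgrad.mul_left
  have ic : ∀ i, Integrable fun p =>
      (Xh η p ^ 2 + Yh η p ^ 2) + pdH (H i) i (fun k => u k p) * η p ^ 2 := fun i =>
    Continuous.integrable_of_hasCompactSupport (by fun_prop) (hgrad.add hη2.mul_left)
  have main : ∀ c ∈ Set.Ioc (0 : ℝ) 1,
      ∑ i, ∫ p, katoDefect (Xh (u i)) (Yh (u i)) p * η p ^ 2
        ≤ ∑ i, (∫ p, (Xh (u i) p ^ 2 + Yh (u i) p ^ 2) * (Xh η p ^ 2 + Yh η p ^ 2))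
          + c * ∑ i, ∫ p, ((Xh η p ^ 2 + Yh η p ^ 2)
            + pdH (H i) i (fun k => u k p) * η p ^ 2) := by
    rintro c ⟨hc, hc1⟩
    set ζ : Fin m → ℝ × ℝ × ℝ → ℝ :=
      fun i q => s i * regNorm (Xh (u i)) (Yh (u i)) c q * η q
    have hζ : ∀ i, ContDiff ℝ 1 (ζ i) := fun i =>
      (contDiff_const.mul ((contDiff_regNorm (n := 2) (hX i) (hY i) hc).of_le
        (by norm_num))).mul hη
    have hζc : ∀ i, HasCompactSupport (ζ i) := fun i => hηc.mul_left
    have hst := hstab ζ hζ hζc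
    have iζ : ∀ i, Integrable fun p => Xh (ζ i) p ^ 2 + Yh (ζ i) p ^ 2 := fun i => by
      have hd : Differentiable ℝ (ζ i) := (hζ i).differentiable (by simp)
      have c1 : Continuous (Xh (ζ i)) := (contDiff_Xh (n := 0) (by simpa using hζ i)).continuous
      have c2 : Continuous (Yh (ζ i)) := (contDiff_Yh (n := 0) (by simpa using hζ i)).continuous
      exact Continuous.integrable_of_hasCompactSupport (by fun_prop)
        ((((hζc i).Xh hd).comp_left (g := fun t => t ^ 2) (by simp)).add
          (((hζc i).Yh hd).comp_left (g := fun t => t ^ 2) (by simp)))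
    have iMζ : ∀ i j, Integrable fun p => pdH (H j) i (fun k => u k p) * ζ i p * ζ j p :=
      fun i j => (((cM j i).mul (hζ i).continuous).mul
        (hζ j).continuous).integrable_of_hasCompactSupport (hζc j).mul_left
    have iLi : ∀ i, Integrable fun p => (Xh (ζ i) p ^ 2 + Yh (ζ i) p ^ 2)
        + ∑ j, pdH (H j) i (fun k => u k p) * ζ i p * ζ j p := fun i =>
      (iζ i).add (integrable_finsetSum _ fun j _ => iMζ i j)
    have iL : Integrable fun p => ∑ i, ((Xh (ζ i) p ^ 2 + Yh (ζ i) p ^ 2)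
        + ∑ j, pdH (H j) i (fun k => u k p) * ζ i p * ζ j p) :=
      integrable_finsetSum _ fun i _ => iLi i
    have hL : 0 ≤ ∫ p, ∑ i, ((Xh (ζ i) p ^ 2 + Yh (ζ i) p ^ 2)
        + ∑ j, pdH (H j) i (fun k => u k p) * ζ i p * ζ j p) := by
      rw [integral_finsetSum _ fun i _ => iLi i]
      have : ∀ i, ∫ p, ((Xh (ζ i) p ^ 2 + Yh (ζ i) p ^ 2)
          + ∑ j, pdH (H j) i (fun k => u k p) * ζ i p * ζ j p)
          = (∫ p, (Xh (ζ i) p ^ 2 + Yh (ζ i) p ^ 2))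
            + ∑ j, ∫ p, pdH (H j) i (fun k => u k p) * ζ i p * ζ j p := fun i => by
        rw [integral_add (iζ i) (integrable_finsetSum _ fun j _ => iMζ i j),
          integral_finsetSum _ fun j _ => iMζ i j]
      rw [Finset.sum_congr rfl fun i _ => this i, Finset.sum_add_distrib]
      linarith
    have iD := fun i => integrable_cutoffDiv (hX i) (hY i) hη hηc
    have iS : ∀ i, Integrable fun p => cutoffDiv (Xh (u i)) (Yh (u i)) η p
        - katoDefect (Xh (u i)) (Yh (u i)) p * η p ^ 2 := fun i => (iD i).1.sub (iq i)
    have iT : ∀ i, Integrable fun p => cutoffDiv (Xh (u i)) (Yh (u i)) η p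
        - katoDefect (Xh (u i)) (Yh (u i)) p * η p ^ 2
        + (Xh (u i) p ^ 2 + Yh (u i) p ^ 2) * (Xh η p ^ 2 + Yh η p ^ 2) := fun i =>
      (iS i).add (iw i)
    have iR : ∀ i, Integrable fun p => cutoffDiv (Xh (u i)) (Yh (u i)) η p
        - katoDefect (Xh (u i)) (Yh (u i)) p * η p ^ 2
        + (Xh (u i) p ^ 2 + Yh (u i) p ^ 2) * (Xh η p ^ 2 + Yh η p ^ 2)
        + c * ((Xh η p ^ 2 + Yh η p ^ 2) + pdH (H i) i (fun k => u k p) * η p ^ 2) := fun i =>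
      (iT i).add ((ic i).const_mul c)
    have hpt : ∀ p i, (Xh (ζ i) p ^ 2 + Yh (ζ i) p ^ 2)
        + ∑ j, pdH (H j) i (fun k => u k p) * ζ i p * ζ j p
        ≤ cutoffDiv (Xh (u i)) (Yh (u i)) η p
          - katoDefect (Xh (u i)) (Yh (u i)) p * η p ^ 2
          + (Xh (u i) p ^ 2 + Yh (u i) p ^ 2) * (Xh η p ^ 2 + Yh η p ^ 2)
          + c * ((Xh η p ^ 2 + Yh η p ^ 2) + pdH (H i) i (fun k => u k p) * η p ^ 2) := by
      intro p i
      have h1 : Xh (ζ i) p ^ 2 + Yh (ζ i) p ^ 2 ≤ _ :=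
        energy_regNorm_mul_le (hX i) (hY i) hηd (hs i) hc hc1 p
      have h2 : ∑ j, pdH (H i) j (fun k => u k p) * ζ i p * ζ j p ≤ _ := coupling_le hs (M := fun i j => pdH (H i) j fun k => u k p)
        (fun i j hij => hM i j hij p) (fun i => Xh (u i)) (fun i => Yh (u i)) hc (η p) p i
      rw [linearized_system hH hu hsys] at h1
      have h3 := mul_nonneg_of_nonpos_of_nonpos (hsign i p) (neg_nonpos.2 (sq_nonneg (η p)))
      simp only [hsymm i]
      linarith
    have hR := hL.trans (integral_mono iL (integrable_finsetSum _ fun i _ => iR i)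
      fun p => Finset.sum_le_sum fun i _ => hpt p i)
    rw [integral_finsetSum _ fun i _ => iR i] at hR
    have : ∀ i, ∫ p, (cutoffDiv (Xh (u i)) (Yh (u i)) η p
        - katoDefect (Xh (u i)) (Yh (u i)) p * η p ^ 2
        + (Xh (u i) p ^ 2 + Yh (u i) p ^ 2) * (Xh η p ^ 2 + Yh η p ^ 2)
        + c * ((Xh η p ^ 2 + Yh η p ^ 2) + pdH (H i) i (fun k => u k p) * η p ^ 2))
        = -(∫ p, katoDefect (Xh (u i)) (Yh (u i)) p * η p ^ 2)
          + (∫ p, (Xh (u i) p ^ 2 + Yh (u i) p ^ 2) * (Xh η p ^ 2 + Yh η p ^ 2))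
          + c * ∫ p, ((Xh η p ^ 2 + Yh η p ^ 2)
            + pdH (H i) i (fun k => u k p) * η p ^ 2) := fun i => by
      rw [integral_add (iT i) ((ic i).const_mul c), integral_add (iS i) (iw i),
        integral_sub (iD i).1 (iq i), (iD i).2,
        integral_const_mul, zero_sub]
    rw [Finset.sum_congr rfl fun i _ => this i, Finset.sum_add_distrib, Finset.sum_add_distrib,
      Finset.sum_neg_distrib, ← Finset.mul_sum] at hR
    linarith
  set K := ∑ i, ∫ p, ((Xh η p ^ 2 + Yh η p ^ 2) + pdH (H i) i (fun k => u k p) * η p ^ 2)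
  have h : Tendsto (fun c : ℝ => ∑ i, (∫ p, (Xh (u i) p ^ 2 + Yh (u i) p ^ 2)
      * (Xh η p ^ 2 + Yh η p ^ 2)) + c * K) (nhds 0) (nhds (_ + 0 * K)) :=
    Continuous.tendsto (by fun_prop) 0
  rw [zero_mul, add_zero] at h
  exact ge_of_tendsto (h.mono_left nhdsWithin_le_nhds)
    (eventually_of_mem (Ioc_mem_nhdsGT one_pos) main)

end Stability

section Cutoff

/-- The fourth power of the Heisenberg norm. -/
def heisQuartic (p : ℝ × ℝ × ℝ) : ℝ := (p.1 ^ 2 + p.2.1 ^ 2) ^ 2 + p.2.2 ^ 2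

lemma contDiff_heisQuartic {n : WithTop ℕ∞} : ContDiff ℝ n heisQuartic := by
  unfold heisQuartic
  fun_prop

lemma sq_Xh_add_sq_Yh_heisQuartic_le (p : ℝ × ℝ × ℝ) :
    Xh heisQuartic p ^ 2 + Yh heisQuartic p ^ 2
      ≤ 16 * (p.1 ^ 2 + p.2.1 ^ 2) * heisQuartic p := by
  have hx : pdx3 heisQuartic p = 4 * (p.1 ^ 2 + p.2.1 ^ 2) * p.1 := by
    have h : HasDerivAt (fun t : ℝ => (t ^ 2 + p.2.1 ^ 2) ^ 2 + p.2.2 ^ 2) _ p.1 :=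
      ((((hasDerivAt_id p.1).pow 2).add_const _).pow 2).add_const _
    rw [pdx3]
    refine h.deriv.trans ?_
    simp
    ring
  have hy : pdy3 heisQuartic p = 4 * (p.1 ^ 2 + p.2.1 ^ 2) * p.2.1 := by
    have h : HasDerivAt (fun t : ℝ => (p.1 ^ 2 + t ^ 2) ^ 2 + p.2.2 ^ 2) _ p.2.1 :=
      ((((hasDerivAt_id p.2.1).pow 2).const_add _).pow 2).add_const _
    rw [pdy3]
    refine h.deriv.trans ?_
    simp
    ring
  have hz : pdz3 heisQuartic p = 2 * p.2.2 := by
    have h : HasDerivAt (fun t : ℝ => (p.1 ^ 2 + p.2.1 ^ 2) ^ 2 + t ^ 2) _ p.2.2 :=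
      ((hasDerivAt_id p.2.2).pow 2).const_add _
    rw [pdz3]
    refine h.deriv.trans ?_
    simp
  rw [Xh, Yh, hx, hy, hz, heisQuartic]
  have : 0 ≤ 15 * (p.1 ^ 2 + p.2.1 ^ 2) * p.2.2 ^ 2 := by positivity
  linarith

lemma subset_box_of_heisQuartic_le (B : ℝ) :
    {p | heisQuartic p ≤ B} ⊆
      Set.Icc (-(B + 2)) (B + 2) ×ˢ Set.Icc (-(B + 2)) (B + 2) ×ˢ Set.Icc (-(B + 2)) (B + 2) := by
  rintro ⟨x, y, z⟩ h
  simp only [heisQuartic, Set.mem_ofPred_eq] at h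
  simp only [Set.mem_prod, Set.mem_Icc, ← abs_le]
  have hx := sq_nonneg x
  have hy := sq_nonneg y
  have h2 := sq_nonneg (x ^ 2 + y ^ 2 - 1)
  have h3 := sq_nonneg z
  refine ⟨abs_le_of_sq_le_sq' ?_ ?_ |> abs_le.2, abs_le_of_sq_le_sq' ?_ ?_ |> abs_le.2,
    abs_le_of_sq_le_sq' ?_ ?_ |> abs_le.2⟩ <;> nlinarith

lemma isCompact_heisQuartic_le (B : ℝ) : IsCompact {p | heisQuartic p ≤ B} :=
  (isCompact_Icc.prod (isCompact_Icc.prod isCompact_Icc)).of_isClosed_subset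
    (isClosed_le (contDiff_heisQuartic (n := 0)).continuous continuous_const)
    (subset_box_of_heisQuartic_le B)

/-- A smooth step, equal to `1` on `(-∞, 1]` and to `0` on `[2, ∞)`. -/
noncomputable def stepDown (t : ℝ) : ℝ := smoothTransition (2 - t)

lemma contDiff_stepDown : ContDiff ℝ 1 stepDown :=
  (smoothTransition.contDiff (n := 1)).comp (contDiff_const.sub contDiff_id)

lemma stepDown_eq_one {t : ℝ} (ht : t ≤ 1) : stepDown t = 1 :=
  smoothTransition.one_of_one_le (by linarith)

lemma stepDown_eq_zero {t : ℝ} (ht : 2 ≤ t) : stepDown t = 0 :=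
  smoothTransition.zero_of_nonpos (by linarith)

lemma deriv_stepDown_eq_zero_of_lt {t : ℝ} (ht : t < 1) : deriv stepDown t = 0 := by
  have h : stepDown =ᶠ[nhds t] fun _ => 1 := by
    filter_upwards [Iio_mem_nhds ht] with r hr using stepDown_eq_one (le_of_lt hr)
  rw [h.deriv_eq, deriv_const]

lemma deriv_stepDown_eq_zero_of_gt {t : ℝ} (ht : 2 < t) : deriv stepDown t = 0 := by
  have h : stepDown =ᶠ[nhds t] fun _ => 0 := by
    filter_upwards [Ioi_mem_nhds ht] with r hr using stepDown_eq_zero (le_of_lt hr)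
  rw [h.deriv_eq, deriv_const]

lemma exists_deriv_stepDown_bound : ∃ K : ℝ, ∀ t, deriv stepDown t ^ 2 ≤ K := by
  have hc : Continuous (deriv stepDown) := contDiff_stepDown.continuous_deriv (by simp)
  obtain ⟨K, hK⟩ := isCompact_Icc.exists_bound_of_continuousOn (s := Set.Icc (1 : ℝ) 2)
    (f := fun t => deriv stepDown t ^ 2) (by fun_prop)
  have hK0 : 0 ≤ K := (norm_nonneg _).trans (hK 1 (by norm_num))
  refine ⟨K, fun t => ?_⟩
  rcases lt_or_ge t 1 with h | h
  · simpa [deriv_stepDown_eq_zero_of_lt h] using hK0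
  rcases lt_or_ge 2 t with h' | h'
  · simpa [deriv_stepDown_eq_zero_of_gt h'] using hK0
  · exact (le_abs_self _).trans (hK t ⟨h, h'⟩)

/-- A cutoff at Heisenberg scale `2 ^ k`. -/
noncomputable def cutoff (k : ℕ) (p : ℝ × ℝ × ℝ) : ℝ := stepDown (heisQuartic p / 16 ^ k)

variable {k l : ℕ} {p : ℝ × ℝ × ℝ}

lemma contDiff_cutoff (k : ℕ) : ContDiff ℝ 1 (cutoff k) :=
  contDiff_stepDown.comp (contDiff_heisQuartic.div_const _)

lemma cutoff_nonneg (k : ℕ) (p : ℝ × ℝ × ℝ) : 0 ≤ cutoff k p := smoothTransition.nonneg _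

lemma cutoff_eq_one (h : heisQuartic p ≤ 16 ^ k) : cutoff k p = 1 :=
  stepDown_eq_one ((div_le_one (by positivity)).2 h)

lemma cutoff_eq_zero (h : 2 * 16 ^ k ≤ heisQuartic p) : cutoff k p = 0 :=
  stepDown_eq_zero ((le_div_iff₀ (by positivity)).2 h)

lemma hasCompactSupport_cutoff (k : ℕ) : HasCompactSupport (cutoff k) :=
  HasCompactSupport.intro (isCompact_heisQuartic_le (2 * 16 ^ k)) fun _ hp =>
    cutoff_eq_zero (not_le.1 hp).le

lemma cutoff_le_cutoff (hkl : k < l) : cutoff k p ≤ cutoff l p := by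
  rcases le_total (2 * 16 ^ k) (heisQuartic p) with h | h
  · rw [cutoff_eq_zero h]
    exact cutoff_nonneg l p
  · have h1 : (16 : ℝ) ^ (k + 1) ≤ 16 ^ l := pow_le_pow_right₀ (by norm_num) hkl
    have h2 : (0 : ℝ) < 16 ^ k := by positivity
    rw [cutoff_eq_one (k := l) (by rw [pow_succ] at h1; linarith)]
    exact smoothTransition.le_one _

lemma Xh_cutoff (k : ℕ) (p : ℝ × ℝ × ℝ) :
    Xh (cutoff k) p = deriv stepDown (heisQuartic p / 16 ^ k) / 16 ^ k * Xh heisQuartic p := by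
  have h : HasDerivAt (fun t : ℝ => stepDown (t / 16 ^ k))
      (deriv stepDown (heisQuartic p / 16 ^ k) * (1 / 16 ^ k)) (heisQuartic p) :=
    HasDerivAt.comp (h₂ := stepDown) (h := fun t : ℝ => t / 16 ^ k) _
      ((contDiff_stepDown.differentiable (by simp)) _).hasDerivAt
      ((hasDerivAt_id _).div_const _)
  rw [← mul_one_div]
  exact Xh_comp h (contDiff_heisQuartic.differentiable one_ne_zero p)

lemma Yh_cutoff (k : ℕ) (p : ℝ × ℝ × ℝ) :
    Yh (cutoff k) p = deriv stepDown (heisQuartic p / 16 ^ k) / 16 ^ k * Yh heisQuartic p := by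
  have h : HasDerivAt (fun t : ℝ => stepDown (t / 16 ^ k))
      (deriv stepDown (heisQuartic p / 16 ^ k) * (1 / 16 ^ k)) (heisQuartic p) :=
    HasDerivAt.comp (h₂ := stepDown) (h := fun t : ℝ => t / 16 ^ k) _
      ((contDiff_stepDown.differentiable (by simp)) _).hasDerivAt
      ((hasDerivAt_id _).div_const _)
  rw [← mul_one_div]
  exact Yh_comp h (contDiff_heisQuartic.differentiable one_ne_zero p)

lemma deriv_stepDown_scale_eq_zero_of_lt (h : heisQuartic p < 16 ^ k) :
    deriv stepDown (heisQuartic p / 16 ^ k) = 0 :=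
  deriv_stepDown_eq_zero_of_lt ((div_lt_one (by positivity)).2 h)

lemma deriv_stepDown_scale_eq_zero_of_gt (h : 2 * 16 ^ k < heisQuartic p) :
    deriv stepDown (heisQuartic p / 16 ^ k) = 0 :=
  deriv_stepDown_eq_zero_of_gt ((lt_div_iff₀ (by positivity)).2 h)

/-- The cutoffs at different scales have gradients with disjoint supports. -/
lemma deriv_stepDown_scale_eq_zero_or (hkl : k < l) (p : ℝ × ℝ × ℝ) :
    deriv stepDown (heisQuartic p / 16 ^ k) = 0 ∨ deriv stepDown (heisQuartic p / 16 ^ l) = 0 := by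
  rcases lt_or_ge (2 * 16 ^ k) (heisQuartic p) with h | h
  · exact .inl (deriv_stepDown_scale_eq_zero_of_gt h)
  · refine .inr (deriv_stepDown_scale_eq_zero_of_lt ?_)
    have h1 : (16 : ℝ) ^ (k + 1) ≤ 16 ^ l := pow_le_pow_right₀ (by norm_num) hkl
    have h2 : (0 : ℝ) < 16 ^ k := by positivity
    rw [pow_succ] at h1
    linarith

lemma deriv_stepDown_scale_mul_eq_zero (hkl : k ≠ l) (p : ℝ × ℝ × ℝ) :
    deriv stepDown (heisQuartic p / 16 ^ k) * deriv stepDown (heisQuartic p / 16 ^ l) = 0 := by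
  rcases lt_or_gt_of_ne hkl with h | h
  · exact mul_eq_zero.2 (deriv_stepDown_scale_eq_zero_or h p)
  · exact mul_eq_zero.2 (deriv_stepDown_scale_eq_zero_or h p).symm

lemma mem_ballH_two_pow_iff : p ∈ ballH (2 ^ k) ↔ heisQuartic p < 16 ^ k := by
  rw [show (16 : ℝ) ^ k = (2 ^ k) ^ 4 by rw [← pow_mul, mul_comm, pow_mul]; norm_num]
  rfl

lemma measurableSet_ballH (R : ℝ) : MeasurableSet (ballH R) :=
  measurableSet_lt (contDiff_heisQuartic (n := 0)).continuous.measurable measurable_const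

lemma gradient_cutoff_le {K : ℝ} (hK : ∀ t, deriv stepDown t ^ 2 ≤ K) (k : ℕ) (p : ℝ × ℝ × ℝ) :
    Xh (cutoff k) p ^ 2 + Yh (cutoff k) p ^ 2
      ≤ (ballH (2 ^ (k + 1))).indicator (fun q => 32 * K / 16 ^ k * (q.1 ^ 2 + q.2.1 ^ 2)) p := by
  have hpos : (0 : ℝ) < 16 ^ k := by positivity
  have e : Xh (cutoff k) p ^ 2 + Yh (cutoff k) p ^ 2
      = deriv stepDown (heisQuartic p / 16 ^ k) ^ 2 / (16 ^ k) ^ 2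
        * (Xh heisQuartic p ^ 2 + Yh heisQuartic p ^ 2) := by
    rw [Xh_cutoff, Yh_cutoff]
    ring
  have hK0 : 0 ≤ K := (sq_nonneg _).trans (hK 0)
  rw [e]
  rcases lt_or_ge (2 * 16 ^ k) (heisQuartic p) with h | h
  · rw [deriv_stepDown_scale_eq_zero_of_gt h]
    simp only [ne_eq, OfNat.ofNat_ne_zero, not_false_eq_true, zero_pow, zero_div, zero_mul]
    exact Set.indicator_nonneg (fun q _ => by positivity) p
  · rw [Set.indicator_of_mem (mem_ballH_two_pow_iff.2 (by rw [pow_succ]; linarith))]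
    calc _ ≤ K / (16 ^ k) ^ 2 * (16 * (p.1 ^ 2 + p.2.1 ^ 2) * (2 * 16 ^ k)) := by
          gcongr
          · exact hK _
          · exact (sq_Xh_add_sq_Yh_heisQuartic_le p).trans (by gcongr)
      _ = _ := by
          field_simp
          ring

/-- The average of `n` consecutive cutoffs beyond scale `M`, a logarithmic cutoff. -/
noncomputable def logCutoff (M n : ℕ) (p : ℝ × ℝ × ℝ) : ℝ :=
  ∑ j ∈ Finset.range n, (1 / (n : ℝ)) * cutoff (M + 1 + j) p

variable {M n : ℕ}

lemma contDiff_logCutoff (M n : ℕ) : ContDiff ℝ 1 (logCutoff M n) :=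
  ContDiff.sum fun _ _ => contDiff_const.mul (contDiff_cutoff _)

lemma hasCompactSupport_logCutoff (M n : ℕ) : HasCompactSupport (logCutoff M n) := by
  refine HasCompactSupport.intro (isCompact_heisQuartic_le (2 * 16 ^ (M + 1 + n))) fun p hp => ?_
  refine Finset.sum_eq_zero fun j hj => ?_
  rw [cutoff_eq_zero, mul_zero]
  refine le_trans ?_ (not_le.1 hp).le
  gcongr
  · norm_num
  · exact (Finset.mem_range.1 hj).le

lemma cutoff_le_logCutoff (hn : 0 < n) : cutoff M p ≤ logCutoff M n p := by
  have hn' : (n : ℝ) ≠ 0 := by positivity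
  calc cutoff M p = ∑ j ∈ Finset.range n, (1 / (n : ℝ)) * cutoff M p := by
        rw [Finset.sum_const, Finset.card_range, nsmul_eq_mul]
        field_simp
    _ ≤ _ := Finset.sum_le_sum fun j _ =>
        mul_le_mul_of_nonneg_left (cutoff_le_cutoff (by omega)) (by positivity)

lemma Xh_logCutoff (M n : ℕ) (p : ℝ × ℝ × ℝ) :
    Xh (logCutoff M n) p = (∑ j ∈ Finset.range n,
      deriv stepDown (heisQuartic p / 16 ^ (M + 1 + j)) / 16 ^ (M + 1 + j))
        * (Xh heisQuartic p / n) := by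
  have hd : ∀ j, Differentiable ℝ (cutoff j) := fun j =>
    (contDiff_cutoff j).differentiable one_ne_zero
  have hconst : Xh (fun _ => 1 / (n : ℝ)) p = 0 := by
    rw [Xh_of_hasFDerivAt (hasFDerivAt_const _ p)]; rfl
  unfold logCutoff
  rw [Xh_sum _ fun j _ => (hd _ p).const_mul _, Finset.sum_mul]
  refine Finset.sum_congr rfl fun j _ => ?_
  rw [Xh_mul (by fun_prop) (hd _ p), hconst, Xh_cutoff]
  ring

lemma Yh_logCutoff (M n : ℕ) (p : ℝ × ℝ × ℝ) :
    Yh (logCutoff M n) p = (∑ j ∈ Finset.range n,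
      deriv stepDown (heisQuartic p / 16 ^ (M + 1 + j)) / 16 ^ (M + 1 + j))
        * (Yh heisQuartic p / n) := by
  have hd : ∀ j, Differentiable ℝ (cutoff j) := fun j =>
    (contDiff_cutoff j).differentiable one_ne_zero
  have hconst : Yh (fun _ => 1 / (n : ℝ)) p = 0 := by
    rw [Yh_of_hasFDerivAt (hasFDerivAt_const _ p)]; rfl
  unfold logCutoff
  rw [Yh_sum _ fun j _ => (hd _ p).const_mul _, Finset.sum_mul]
  refine Finset.sum_congr rfl fun j _ => ?_
  rw [Yh_mul (by fun_prop) (hd _ p), hconst, Yh_cutoff]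
  ring

lemma gradient_logCutoff (M n : ℕ) (p : ℝ × ℝ × ℝ) :
    Xh (logCutoff M n) p ^ 2 + Yh (logCutoff M n) p ^ 2
      = 1 / (n : ℝ) ^ 2 * ∑ j ∈ Finset.range n,
        (Xh (cutoff (M + 1 + j)) p ^ 2 + Yh (cutoff (M + 1 + j)) p ^ 2) := by
  set d : ℕ → ℝ := fun j => deriv stepDown (heisQuartic p / 16 ^ (M + 1 + j)) / 16 ^ (M + 1 + j)
    with hd
  have horth : (∑ j ∈ Finset.range n, d j) ^ 2 = ∑ j ∈ Finset.range n, d j ^ 2 := by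
    rw [sq, Finset.sum_mul_sum]
    refine Finset.sum_congr rfl fun i hi => ?_
    rw [Finset.sum_eq_single_of_mem i hi fun j _ hij => ?_, sq]
    simp only [hd]
    rw [div_mul_div_comm, deriv_stepDown_scale_mul_eq_zero (by omega), zero_div]
  have hsum : ∑ j ∈ Finset.range n,
      (Xh (cutoff (M + 1 + j)) p ^ 2 + Yh (cutoff (M + 1 + j)) p ^ 2)
      = (∑ j ∈ Finset.range n, d j ^ 2) * (Xh heisQuartic p ^ 2 + Yh heisQuartic p ^ 2) := by
    rw [Finset.sum_mul]
    refine Finset.sum_congr rfl fun j _ => ?_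
    rw [Xh_cutoff, Yh_cutoff]
    simp only [hd]
    ring
  rw [hsum, ← horth, Xh_logCutoff, Yh_logCutoff]
  ring

lemma integral_mul_gradient_cutoff_le {K C : ℝ} (hK : ∀ t, deriv stepDown t ^ 2 ≤ K)
    {w : ℝ × ℝ × ℝ → ℝ} (hw : Continuous w) (hw0 : ∀ p, 0 ≤ w p)
    (hgrow : ∀ R > (1 : ℝ), ∫ p in ballH R, (p.1 ^ 2 + p.2.1 ^ 2) * w p ≤ C * R ^ 4) (k : ℕ) :
    ∫ p, w p * (Xh (cutoff k) p ^ 2 + Yh (cutoff k) p ^ 2) ≤ 512 * K * C := by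
  have hK0 : 0 ≤ K := (sq_nonneg _).trans (hK 0)
  have hi : IntegrableOn (fun p : ℝ × ℝ × ℝ => 32 * K / 16 ^ k * ((p.1 ^ 2 + p.2.1 ^ 2) * w p))
      (ballH (2 ^ (k + 1))) :=
    ((by fun_prop : Continuous _).continuousOn.integrableOn_compact
      (isCompact_heisQuartic_le (16 ^ (k + 1)))).mono_set
      fun p hp => (mem_ballH_two_pow_iff.1 hp).le
  calc ∫ p, w p * (Xh (cutoff k) p ^ 2 + Yh (cutoff k) p ^ 2)
      ≤ ∫ p, (ballH (2 ^ (k + 1))).indicator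
          (fun p => 32 * K / 16 ^ k * ((p.1 ^ 2 + p.2.1 ^ 2) * w p)) p := by
        refine integral_mono_of_nonneg (.of_forall fun p => ?_)
          (hi.integrable_indicator (measurableSet_ballH _)) (.of_forall fun p => ?_)
        · exact mul_nonneg (hw0 p) (by positivity)
        · refine (mul_le_mul_of_nonneg_left (gradient_cutoff_le hK k p) (hw0 p)).trans_eq ?_
          by_cases hp : p ∈ ballH (2 ^ (k + 1))
          · rw [Set.indicator_of_mem hp, Set.indicator_of_mem hp]
            ring
          · rw [Set.indicator_of_notMem hp, Set.indicator_of_notMem hp, mul_zero]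
    _ = 32 * K / 16 ^ k * ∫ p in ballH (2 ^ (k + 1)), (p.1 ^ 2 + p.2.1 ^ 2) * w p := by
        rw [integral_indicator (measurableSet_ballH _), integral_const_mul]
    _ ≤ 32 * K / 16 ^ k * (C * (2 ^ (k + 1)) ^ 4) := by
        gcongr
        exact hgrow _ (one_lt_pow₀ one_lt_two (by omega))
    _ = 512 * K * C := by
        rw [show ((2 : ℝ) ^ (k + 1)) ^ 4 = 16 * 16 ^ k by
          rw [← pow_mul, mul_comm, pow_mul, pow_succ]; norm_num; ring]
        field_simp
        ring

lemma integral_mul_gradient_logCutoff_le {K C : ℝ} (hK : ∀ t, deriv stepDown t ^ 2 ≤ K)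
    {w : ℝ × ℝ × ℝ → ℝ} (hw : Continuous w) (hw0 : ∀ p, 0 ≤ w p)
    (hgrow : ∀ R > (1 : ℝ), ∫ p in ballH R, (p.1 ^ 2 + p.2.1 ^ 2) * w p ≤ C * R ^ 4)
    (M : ℕ) {n : ℕ} (hn : 0 < n) :
    ∫ p, w p * (Xh (logCutoff M n) p ^ 2 + Yh (logCutoff M n) p ^ 2) ≤ 512 * K * C / n := by
  have hi : ∀ k, Integrable fun p => w p * (Xh (cutoff k) p ^ 2 + Yh (cutoff k) p ^ 2) := by
    intro k
    have h0 := contDiff_cutoff k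
    have hd : Differentiable ℝ (cutoff k) := h0.differentiable one_ne_zero
    have c1 : Continuous (Xh (cutoff k)) := (contDiff_Xh (n := 0) (by simpa using h0)).continuous
    have c2 : Continuous (Yh (cutoff k)) := (contDiff_Yh (n := 0) (by simpa using h0)).continuous
    have hc := hasCompactSupport_cutoff k
    refine Continuous.integrable_of_hasCompactSupport (by fun_prop) (HasCompactSupport.mul_left ?_)
    exact ((hc.Xh hd).comp_left (g := fun t => t ^ 2) (by simp)).add
      ((hc.Yh hd).comp_left (g := fun t => t ^ 2) (by simp))
  have hn' : (0 : ℝ) < n := by exact_mod_cast hn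
  calc ∫ p, w p * (Xh (logCutoff M n) p ^ 2 + Yh (logCutoff M n) p ^ 2)
      = 1 / (n : ℝ) ^ 2 * ∑ j ∈ Finset.range n,
          ∫ p, w p * (Xh (cutoff (M + 1 + j)) p ^ 2 + Yh (cutoff (M + 1 + j)) p ^ 2) := by
        rw [← integral_finsetSum _ fun j _ => hi _, ← integral_const_mul]
        refine integral_congr_ae (.of_forall fun p => ?_)
        dsimp only
        rw [gradient_logCutoff, ← Finset.mul_sum]
        ring
    _ ≤ 1 / (n : ℝ) ^ 2 * ∑ j ∈ Finset.range n, 512 * K * C := by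
        gcongr
        exact integral_mul_gradient_cutoff_le hK hw hw0 hgrow _
    _ = 512 * K * C / n := by
        rw [Finset.sum_const, Finset.card_range, nsmul_eq_mul]
        field_simp

/-- A Liouville-type principle: a nonnegative continuous function controlled by the weighted
gradients of all cutoffs vanishes. -/
lemma eq_zero_of_integral_mul_sq_le {m : ℕ} {C : ℝ} {w : Fin m → ℝ × ℝ × ℝ → ℝ}
    (hw : ∀ i, Continuous (w i)) (hw0 : ∀ i p, 0 ≤ w i p)
    (hgrow : ∀ R > (1 : ℝ), ∀ i, ∫ p in ballH R, (p.1 ^ 2 + p.2.1 ^ 2) * w i p ≤ C * R ^ 4)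
    {q : ℝ × ℝ × ℝ → ℝ} (hq : Continuous q) (hq0 : ∀ p, 0 ≤ q p)
    (h : ∀ η : ℝ × ℝ × ℝ → ℝ, ContDiff ℝ 1 η → HasCompactSupport η →
      ∫ p, q p * η p ^ 2 ≤ ∑ i, ∫ p, w i p * (Xh η p ^ 2 + Yh η p ^ 2)) (p : ℝ × ℝ × ℝ) :
    q p = 0 := by
  obtain ⟨K, hK⟩ := exists_deriv_stepDown_bound
  obtain ⟨M, hM⟩ := pow_unbounded_of_one_lt (heisQuartic p) (by norm_num : (1 : ℝ) < 16)
  have hcs {η : ℝ × ℝ × ℝ → ℝ} (hη : HasCompactSupport η) :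
      HasCompactSupport fun p => q p * η p ^ 2 := by
    have hη2 : HasCompactSupport fun p => η p ^ 2 :=
      hη.comp_left (g := fun t : ℝ => t ^ 2) (by simp)
    exact hη2.mul_left
  have hi (η : ℝ × ℝ × ℝ → ℝ) (h1 : ContDiff ℝ 1 η) (h2 : HasCompactSupport η) :
      Integrable fun p => q p * η p ^ 2 :=
    (hq.mul (h1.continuous.pow 2)).integrable_of_hasCompactSupport (hcs h2)
  have hle (n : ℕ) : ∫ p, q p * cutoff M p ^ 2 ≤ m * (512 * K * C) / ((n : ℝ) + 1) := by
    have hn : 0 < n + 1 := n.succ_pos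
    have h1 : ∫ p, q p * cutoff M p ^ 2 ≤ ∫ p, q p * logCutoff M (n + 1) p ^ 2 :=
      integral_mono (hi _ (contDiff_cutoff M) (hasCompactSupport_cutoff M))
        (hi _ (contDiff_logCutoff M _) (hasCompactSupport_logCutoff M _)) fun p =>
        mul_le_mul_of_nonneg_left (pow_le_pow_left₀ (cutoff_nonneg M p)
          (cutoff_le_logCutoff hn) 2) (hq0 p)
    have h2 := h _ (contDiff_logCutoff M (n + 1)) (hasCompactSupport_logCutoff M (n + 1))
    have h3 := Finset.sum_le_sum fun i (_ : i ∈ Finset.univ) =>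
      integral_mul_gradient_logCutoff_le hK (hw i) (hw0 i) (fun R hR => hgrow R hR i) M hn
    refine (h1.trans (h2.trans h3)).trans_eq ?_
    rw [Finset.sum_const, Finset.card_univ, Fintype.card_fin, nsmul_eq_mul, ← mul_div_assoc,
      Nat.cast_add_one]
  have hlim : Tendsto (fun n : ℕ => m * (512 * K * C) / ((n : ℝ) + 1)) atTop (nhds 0) :=
    (tendsto_const_nhds (x := m * (512 * K * C))).div_atTop
      (tendsto_atTop_add_const_right _ _ tendsto_natCast_atTop_atTop)
  have h0 : ∫ p, q p * cutoff M p ^ 2 ≤ 0 := ge_of_tendsto' hlim hle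
  by_contra hne
  refine h0.not_gt ((hq.mul ((contDiff_cutoff M).continuous.pow
    2)).integral_pos_of_hasCompactSupport_nonneg_nonzero (x := p) ?_ ?_ ?_)
  · exact hcs (hasCompactSupport_cutoff M)
  · exact fun p => mul_nonneg (hq0 p) (sq_nonneg _)
  · simpa [cutoff_eq_one hM.le] using hne

end Cutoff

/-- Flatness of level sets for stable, orientable solutions of the
symmetric Heisenberg system on `ℝ³`: under the sign and growth assumptions, the intrinsic
curvature term and the tangential term vanish wherever `|∇_H u_i| ≠ 0`. -/
theorem stmt_12 {m : ℕ}
    (H : Fin m → (Fin m → ℝ) → ℝ) (hH : ∀ i, ContDiff ℝ 1 (H i))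
    (hsymm : ∀ i j v, pdH (H j) i v = pdH (H i) j v)
    (u : Fin m → ℝ × ℝ × ℝ → ℝ) (hu : ∀ i, ContDiff ℝ 3 (u i))
    (hsys : ∀ i p, deltaH (u i) p = H i (fun j => u j p))
    -- stability
    (hstab : ∀ ζ : Fin m → ℝ × ℝ × ℝ → ℝ, (∀ i, ContDiff ℝ 1 (ζ i)) →
      (∀ i, HasCompactSupport (ζ i)) →
      (-(∑ i, ∑ j, ∫ p, pdH (H j) i (fun k => u k p) * ζ i p * ζ j p))
        ≤ ∑ i, ∫ p, ((Xh (ζ i) p) ^ 2 + (Yh (ζ i) p) ^ 2))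
    -- orientability along u
    (horient : ∃ θ : Fin m → ℝ × ℝ × ℝ → ℝ,
      (∀ i, (∀ p, 0 < θ i p) ∨ (∀ p, θ i p < 0)) ∧
      (∀ i j, i ≠ j → ∀ p, pdH (H i) j (fun k => u k p) * θ i p * θ j p < 0))
    -- sign assumption on the commutator terms
    (hsign : ∀ i p, Zh (Yh (u i)) p * Xh (u i) p - Zh (Xh (u i)) p * Yh (u i) p ≤ 0)
    -- growth-decay assumption
    (C : ℝ)
    (hgrow : ∀ R > (1 : ℝ), ∀ i,
      (∫ p in ballH R, (p.1 ^ 2 + p.2.1 ^ 2) * (normH (u i) p) ^ 2) ≤ C * R ^ 4) :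
    ∀ i, ∀ p, normH (u i) p ≠ 0 →
      (Xh (Xh (u i)) p * (Yh (u i) p) ^ 2 - Xh (Yh (u i)) p * Xh (u i) p * Yh (u i) p
        - Yh (Xh (u i)) p * Xh (u i) p * Yh (u i) p
        + Yh (Yh (u i)) p * (Xh (u i) p) ^ 2 = 0) ∧
      (Xh (Xh (u i)) p * Xh (u i) p * Yh (u i) p - Xh (Yh (u i)) p * (Xh (u i) p) ^ 2
        + Yh (Xh (u i)) p * (Yh (u i) p) ^ 2
        - Yh (Yh (u i)) p * Xh (u i) p * Yh (u i) p = 0) := by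

  intro i p _
  have hX : ∀ i, ContDiff ℝ 2 (Xh (u i)) := fun i => contDiff_Xh (n := 2) (hu i)
  have hY : ∀ i, ContDiff ℝ 2 (Yh (u i)) := fun i => contDiff_Yh (n := 2) (hu i)
  have hq : katoDefect (Xh (u i)) (Yh (u i)) p = 0 := by
    refine eq_zero_of_integral_mul_sq_le (w := fun i p => Xh (u i) p ^ 2 + Yh (u i) p ^ 2) (C := C)
      (fun i => ((hX i).continuous.pow 2).add ((hY i).continuous.pow 2))
      (fun i p => by positivity) (fun R hR i => ?_) (continuous_katoDefect (hX i) (hY i))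
      (katoDefect_nonneg _ _) (fun η hη hηc => ?_) p
    · have hn : ∀ p, normH (u i) p ^ 2 = Xh (u i) p ^ 2 + Yh (u i) p ^ 2 := fun p =>
        Real.sq_sqrt (by positivity)
      simpa only [hn] using hgrow R hR i
    · refine le_trans ?_
        (sum_integral_katoDefect_le hH hsymm hu hsys hstab horient hsign hη hηc)
      exact Finset.single_le_sum
        (f := fun i => ∫ p, katoDefect (Xh (u i)) (Yh (u i)) p * η p ^ 2)
        (fun j _ => integral_nonneg fun p => mul_nonneg (katoDefect_nonneg _ _ p) (sq_nonneg _))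
        (Finset.mem_univ i)
  rw [katoDefect, div_eq_zero_iff, or_iff_left (by positivity),
    add_eq_zero_iff_of_nonneg (sq_nonneg _) (sq_nonneg _), sq_eq_zero_iff, sq_eq_zero_iff] at hq
  obtain ⟨hA, hB⟩ := hq
  constructor
  · linear_combination (-Yh (u i) p) * hA + Xh (u i) p * hB
  · linear_combination (-Xh (u i) p) * hA - Yh (u i) p * hB
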